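/- arXiv:2402.11918 — 2 statements merged into one kernel-verified Lean document; each statement's English description precedes it below -/
import Mathlib

section
/- (Property R1.) Let X be a subset of H. Then every super-stable matching μ in the induced subgraph G⟨V \ X⟩ satisfies μ ⊆ E \ B_X, i.e., no edge of μ belongs to B_X. -/
open Set

/-- `incid v e` : edge `e` is incident to vertex `v`. -/
def incid {V : Type*} (v : V) (e : V × V) : Prop := e.1 = v ∨ e.2 = v

/-- An instance of the super-stable matching problem with ties: a finite simple
bipartite graph whose vertices are partitioned into doctors `Dset` and
hospitals `Hset`, each edge `(d,h)` joining a doctor to a hospital, together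
with, for each vertex `v`, a transitive and total preference relation
`pref v` (possibly with ties) on the edges incident to `v`. -/
structure SMInstance (V : Type*) where
  Dset : Set V
  Hset : Set V
  E : Set (V × V)
  pref : V → (V × V) → (V × V) → Prop
  disj : Disjoint Dset Hset
  cover : Dset ∪ Hset = Set.univ
  edge_mem : ∀ e ∈ E, e.1 ∈ Dset ∧ e.2 ∈ Hset
  pref_total : ∀ v, ∀ e ∈ E, ∀ f ∈ E, incid v e → incid v f →
    pref v e f ∨ pref v f e
  pref_trans : ∀ v, ∀ e ∈ E, ∀ f ∈ E, ∀ g ∈ E,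
    incid v e → incid v f → incid v g →
    pref v e f → pref v f g → pref v e g

namespace SMInstance

variable {V : Type*} (I : SMInstance V)

/-- Strict preference `e ≻_v f`. -/
def sprefer (v : V) (e f : V × V) : Prop := I.pref v e f ∧ ¬ I.pref v f e

/-- `Ch_d(F)` for a doctor `d`. -/
def Chd (d : V) (F : Set (V × V)) : Set (V × V) :=
  {e ∈ F | incid d e ∧ ∀ f ∈ F, incid d f → I.pref d e f}

/-- `Ch_h(F)` for a hospital `h`. -/
def Chh (h : V) (F : Set (V × V)) : Set (V × V) :=
  {e ∈ F | incid h e ∧ ∀ f ∈ F, incid h f → f ≠ e → I.sprefer h e f}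

/-- `Ch_D(F) = ⋃_{d ∈ D} Ch_d(F)`. -/
def ChD (F : Set (V × V)) : Set (V × V) := ⋃ d ∈ I.Dset, I.Chd d F

/-- `Ch_H(F) = ⋃_{h ∈ H} Ch_h(F)`. -/
def ChH (F : Set (V × V)) : Set (V × V) := ⋃ h ∈ I.Hset, I.Chh h F

/-- `D[F]` : the set of doctors incident to some edge of `F`. -/
def docs (F : Set (V × V)) : Set V := {d ∈ I.Dset | ∃ e ∈ F, incid d e}

/-- The sequence `R_{X,t}` of the preprocessing algorithm:
`R_{X,0} = E(X)`, and `R_{X,t+1} = R_{X,t} ∪ (P_{X,t+1} \ Q_{X,t+1})` where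
`P_{X,t+1} = Ch_D(E \ R_{X,t})` and
`Q_{X,t+1} = Ch_H(P_{X,t+1} ∪ R_{X,t}) ∩ P_{X,t+1}`. -/
def R (X : Set V) : ℕ → Set (V × V)
  | 0 => {e ∈ I.E | e.2 ∈ X}
  | t + 1 =>
      R X t ∪
        (I.ChD (I.E \ R X t) \
          (I.ChH (I.ChD (I.E \ R X t) ∪ R X t) ∩ I.ChD (I.E \ R X t)))

/-- `k_X` : the least `t ≥ 1` with `R_{X,t} = R_{X,t-1}`. -/
noncomputable def kX (X : Set V) : ℕ :=
  sInf {t : ℕ | 1 ≤ t ∧ I.R X t = I.R X (t - 1)}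

/-- `B_X = R_{X,k_X}`. -/
noncomputable def B (X : Set V) : Set (V × V) := I.R X (I.kX X)

/-- A matching in the induced subgraph `G⟨V \ X⟩`. -/
def isMatching (X : Set V) (μ : Set (V × V)) : Prop :=
  μ ⊆ I.E ∧ (∀ e ∈ μ, e.1 ∉ X ∧ e.2 ∉ X) ∧
    ∀ v, ∀ e ∈ μ, ∀ f ∈ μ, incid v e → incid v f → e = f

/-- `e = (d,h)` blocks the matching `μ` of `G⟨V \ X⟩`:
`e ∈ E⟨V \ X⟩ \ μ`, `e ≿_d μ(d)` and `e ≿_h μ(h)`. -/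
def blocks (X : Set V) (μ : Set (V × V)) (e : V × V) : Prop :=
  e ∈ I.E ∧ e.1 ∉ X ∧ e.2 ∉ X ∧ e ∉ μ ∧
    (∀ f ∈ μ, incid e.1 f → I.pref e.1 e f) ∧
    (∀ f ∈ μ, incid e.2 f → I.pref e.2 e f)

/-- `μ` is a super-stable matching in `G⟨V \ X⟩`. -/
def superStable (X : Set V) (μ : Set (V × V)) : Prop :=
  I.isMatching X μ ∧ ∀ e, ¬ I.blocks X μ e

/-- `X` is feasible: `G⟨V \ X⟩` admits a super-stable matching. -/
def feasible (X : Set V) : Prop := ∃ μ, I.superStable X μ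

/-- `h` is a critical hospital with respect to `(B_X, μ_X)`:
`μ_X(h) = ∅` and at least one of `B_X(h) ≠ ∅` and
`Ch_D(E \ B_X) ∩ E(h) ≠ ∅` holds. -/
def critical (X : Set V) (μ : Set (V × V)) (h : V) : Prop :=
  h ∈ I.Hset ∧ (∀ e ∈ μ, ¬ incid h e) ∧
    ((∃ e ∈ I.B X, incid h e) ∨ ∃ e ∈ I.ChD (I.E \ I.B X), incid h e)

end SMInstance

namespace SMInstance

variable {V : Type*} {I : SMInstance V}

/-- A vertex that is not a doctor is incident only to edges in which it is the hospital. -/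
theorem snd_eq_of_incid {e : V × V} {h : V} (he : e ∈ I.E) (hh : h ∈ I.Hset)
    (hi : incid h e) : e.2 = h :=
  hi.resolve_left fun h1 =>
    Set.disjoint_left.1 I.disj (I.edge_mem e he).1 (h1 ▸ hh)

/-- A vertex that is not a hospital is incident only to edges in which it is the doctor. -/
theorem fst_eq_of_incid {e : V × V} {d : V} (he : e ∈ I.E) (hd : d ∈ I.Dset)
    (hi : incid d e) : e.1 = d :=
  hi.resolve_right fun h2 =>
    Set.disjoint_left.1 I.disj hd (h2 ▸ (I.edge_mem e he).2)

theorem pref_of_mem_ChD {F : Set (V × V)} (hF : F ⊆ I.E) {e : V × V} (he : e ∈ I.ChD F) :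
    e ∈ F ∧ ∀ f ∈ F, incid e.1 f → I.pref e.1 e f := by
  simp only [ChD, Set.mem_iUnion] at he
  obtain ⟨d, hd, heF, hi, hp⟩ := he
  obtain rfl := fst_eq_of_incid (hF heF) hd hi
  exact ⟨heF, hp⟩

/-- An edge not chosen by its hospital has a weakly preferred competitor there. -/
theorem exists_pref_of_notMem_ChH {F : Set (V × V)} (hF : F ⊆ I.E) {e : V × V}
    (heF : e ∈ F) (he : e ∉ I.ChH F) :
    ∃ f ∈ F, f ≠ e ∧ f.2 = e.2 ∧ I.pref e.2 f e := by
  have hH := (I.edge_mem e (hF heF)).2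
  by_contra! hno
  refine he (Set.mem_biUnion hH ⟨heF, Or.inr rfl, fun f hf hi hne => ?_⟩)
  have hnp := hno f hf hne (snd_eq_of_incid (hF hf) hH hi)
  exact ⟨(I.pref_total e.2 e (hF heF) f (hF hf) (Or.inr rfl) hi).resolve_right hnp, hnp⟩

theorem R_subset_succ (X : Set V) (t : ℕ) : I.R X t ⊆ I.R X (t + 1) :=
  Set.subset_union_left

/-- Every edge of `R_{X,t}` outside `E(X)` is weakly preferred by its doctor to every edge
outside `R_{X,t}`. -/
theorem pref_of_mem_R (X : Set V) (t : ℕ) {e : V × V} (he : e ∈ I.R X t) :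
    e ∈ I.E ∧ (e.2 ∉ X → ∀ f ∈ I.E \ I.R X t, incid e.1 f → I.pref e.1 e f) := by
  induction t with
  | zero => exact ⟨he.1, fun h => absurd he.2 h⟩
  | succ t ih =>
    have hsub : I.E \ I.R X (t + 1) ⊆ I.E \ I.R X t :=
      Set.sdiff_subset_sdiff_right (R_subset_succ X t)
    rcases he with he | he
    · exact ⟨(ih he).1, fun hX f hf => (ih he).2 hX f (hsub hf)⟩
    · have h := pref_of_mem_ChD Set.sdiff_subset he.1
      exact ⟨h.1.1, fun _ f hf => h.2 f (hsub hf)⟩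

theorem superStable.disjoint_R {X : Set V} (hX : X ⊆ I.Hset) {μ : Set (V × V)}
    (hμ : I.superStable X μ) (t : ℕ) : Disjoint μ (I.R X t) := by
  obtain ⟨⟨hE, hXμ, hmatch⟩, hstable⟩ := hμ
  induction t with
  | zero => exact Set.disjoint_left.2 fun e he h => (hXμ e he).2 h.2
  | succ t ih =>
    have hout : μ ⊆ I.E \ I.R X t := fun e he => ⟨hE he, Set.disjoint_left.1 ih he⟩
    refine Set.disjoint_left.2 fun e he h => ?_
    rcases h with h | ⟨hP, hQ⟩
    · exact Set.disjoint_left.1 ih he h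
    have hF : I.ChD (I.E \ I.R X t) ∪ I.R X t ⊆ I.E :=
      Set.union_subset (fun f hf => (pref_of_mem_ChD Set.sdiff_subset hf).1.1)
        fun f hf => (pref_of_mem_R X t hf).1
    obtain ⟨f, hf, hne, hfe, hpref⟩ :=
      exists_pref_of_notMem_ChH hF (Or.inl hP) fun h => hQ ⟨h, hP⟩
    have hfX : f.2 ∉ X := hfe ▸ (hXμ e he).2
    refine hstable f ⟨hF hf, fun h => ?_, hfX, fun h => ?_, fun g hg hi => ?_,
      fun g hg hi => ?_⟩
    · exact Set.disjoint_left.1 I.disj (I.edge_mem f (hF hf)).1 (hX h)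
    · exact hne (hmatch e.2 f h e he (Or.inr hfe) (Or.inr rfl))
    · rcases hf with hf | hf
      · exact (pref_of_mem_ChD Set.sdiff_subset hf).2 g (hout hg) hi
      · exact (pref_of_mem_R X t hf).2 hfX g (hout hg) hi
    · rw [hfe] at hi ⊢
      rwa [hmatch e.2 g hg e he hi (Or.inr rfl)]

end SMInstance

/-- (Property R1.) Let `X ⊆ H`. Then every super-stable matching `μ` in
`G⟨V \ X⟩` satisfies `μ ⊆ E \ B_X`, i.e., no edge of `μ` belongs to `B_X`. -/
theorem statement4 {V : Type*} [Fintype V] (I : SMInstance V)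
    (X : Set V) (hX : X ⊆ I.Hset)
    (μ : Set (V × V)) (hμ : I.superStable X μ) :
    μ ⊆ I.E \ I.B X :=
  Set.subset_sdiff.2 ⟨hμ.1.1, hμ.disjoint_R hX _⟩
end

section
/- (Property R2.) For every subset X ⊆ H, the inclusion B_∅ ⊆ B_X holds, where B_∅ is the edge set produced by the preprocessing algorithm for the empty deletion set and B_X is the edge set produced for X. -/
open Set

namespace SMInstance

variable {V : Type*} (I : SMInstance V)

theorem mem_ChD_of_subset {F G : Set (V × V)} (hFG : F ⊆ G) {e : V × V} (he : e ∈ I.ChD G)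
    (heF : e ∈ F) : e ∈ I.ChD F := by
  simp only [ChD, mem_iUnion₂] at he ⊢
  obtain ⟨d, hd, -, hinc, hbest⟩ := he
  exact ⟨d, hd, heF, hinc, fun f hf => hbest f (hFG hf)⟩

theorem mem_ChH_of_subset {F G : Set (V × V)} (hFG : F ⊆ G) {e : V × V} (he : e ∈ I.ChH G)
    (heF : e ∈ F) : e ∈ I.ChH F := by
  simp only [ChH, mem_iUnion₂] at he ⊢
  obtain ⟨h, hh, -, hinc, hbest⟩ := he
  exact ⟨h, hh, heF, hinc, fun f hf => hbest f (hFG hf)⟩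

theorem ChD_subset (F : Set (V × V)) : I.ChD F ⊆ F :=
  iUnion₂_subset fun _ _ _ he => he.1

theorem R_monotone (X : Set V) : Monotone (I.R X) :=
  monotone_nat_of_le_succ fun _ => subset_union_left

theorem kX_spec [Finite V] (X : Set V) : 1 ≤ I.kX X ∧ I.R X (I.kX X) = I.R X (I.kX X - 1) := by
  obtain ⟨n, hn⟩ := WellFoundedGT.monotone_chain_condition ⟨I.R X, I.R_monotone X⟩
  exact Nat.sInf_mem (s := {t : ℕ | 1 ≤ t ∧ I.R X t = I.R X (t - 1)})
    ⟨n + 1, Nat.le_add_left 1 n, (hn (n + 1) n.le_succ).symm⟩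

/-- Every edge proposed when `B_X` is rejected is accepted by its hospital. -/
theorem ChD_diff_B_subset [Finite V] (X : Set V) :
    I.ChD (I.E \ I.B X) ⊆ I.ChH (I.ChD (I.E \ I.B X) ∪ I.B X) := by
  obtain ⟨hpos, hfix⟩ := I.kX_spec X
  obtain ⟨n, hn⟩ : ∃ n, I.kX X = n + 1 := ⟨I.kX X - 1, by omega⟩
  rw [hn, Nat.add_sub_cancel] at hfix
  have hB : I.B X = I.R X n := by rw [B, hn, hfix]
  rw [hB]
  intro e he
  by_contra hne
  have hmem : e ∈ I.R X (n + 1) := Or.inr ⟨he, fun hQ => hne hQ.1⟩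
  rw [hfix] at hmem
  exact (I.ChD_subset _ he).2 hmem

theorem R_empty_subset_B [Finite V] (X : Set V) (t : ℕ) : I.R ∅ t ⊆ I.B X := by
  induction t with
  | zero => exact fun e he => he.2.elim
  | succ t ih =>
    have hP : ∀ f ∈ I.ChD (I.E \ I.R ∅ t), f ∉ I.B X → f ∈ I.ChD (I.E \ I.B X) :=
      fun f hf hfB => I.mem_ChD_of_subset (sdiff_subset_sdiff_right ih) hf
        ⟨(I.ChD_subset _ hf).1, hfB⟩
    have hsub : I.ChD (I.E \ I.R ∅ t) ∪ I.R ∅ t ⊆ I.ChD (I.E \ I.B X) ∪ I.B X := by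
      rintro f (hf | hf)
      · by_cases hfB : f ∈ I.B X
        · exact Or.inr hfB
        · exact Or.inl (hP f hf hfB)
      · exact Or.inr (ih hf)
    rintro e (he | ⟨heP, heQ⟩)
    · exact ih he
    · by_contra heB
      exact heQ ⟨I.mem_ChH_of_subset hsub (I.ChD_diff_B_subset X (hP e heP heB)) (Or.inl heP), heP⟩

end SMInstance

/-- (Property R2.) For every subset `X ⊆ H`, we have `B_∅ ⊆ B_X`. -/
theorem statement6 {V : Type*} [Fintype V] (I : SMInstance V)
    (X : Set V) (hX : X ⊆ I.Hset) :
    I.B (∅ : Set V) ⊆ I.B X :=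
  I.R_empty_subset_B X (I.kX ∅)
end
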